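/- Let m_0 = ⌈n √(log n)⌉ and, for a constant γ > 0, let T = T(m_0, ⌊γ n log n⌋). With high probability, the number of indices m ∈ T such that |D_m| > (1/2 + (log n)^{−1/10}) n is at most γ n (log n)^{9/10}. -/

import Mathlib

open scoped Classical

noncomputable section

/-- `M` is a matching in the graph `G`: a set of edges of `G` that are pairwise disjoint. -/
def IsMatchingOn {n : ℕ} (G : SimpleGraph (Fin n)) (M : Finset (Sym2 (Fin n))) : Prop :=
  (∀ e ∈ M, e ∈ G.edgeSet) ∧
  ∀ e ∈ M, ∀ f ∈ M, e ≠ f → ∀ v : Fin n, v ∈ e → v ∉ f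

/-- ν(G): the maximum size of a matching of `G`. -/
def matchNum {n : ℕ} (G : SimpleGraph (Fin n)) : ℕ :=
  sSup {k | ∃ M : Finset (Sym2 (Fin n)), IsMatchingOn G M ∧ M.card = k}

/-- `C` is a vertex cover of `G`. -/
def IsVertexCover {n : ℕ} (G : SimpleGraph (Fin n)) (C : Finset (Fin n)) : Prop :=
  ∀ e ∈ G.edgeSet, ∃ v ∈ C, v ∈ e

/-- τ(G): the minimum size of a vertex cover of `G`. -/
def coverNum {n : ℕ} (G : SimpleGraph (Fin n)) : ℕ :=
  sInf {k | ∃ C : Finset (Fin n), IsVertexCover G C ∧ C.card = k}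

/-- `G` is a König graph: ν(G) = τ(G). -/
def IsKonig {n : ℕ} (G : SimpleGraph (Fin n)) : Prop := matchNum G = coverNum G

/-- An ordering `e_1, …, e_N` (0-indexed: `σ 0, …, σ (N-1)`) of the `N = n(n-1)/2` edges of
the complete graph on `Fin n`: an injective function from `Fin N` to non-diagonal elements
of `Sym2 (Fin n)`, hence a bijection onto the edge set of `K_n`. -/
def EdgeOrdering (n : ℕ) : Type :=
  {σ : Fin (n*(n-1)/2) → Sym2 (Fin n) // Function.Injective σ ∧ ∀ i, ¬ (σ i).IsDiag}

/-- The König process: `KonigProc σ m` is the graph `G_m`, where `G_0 = ⊥` and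
`G_{m+1} = G_m + e_{m+1}` if that graph is König, `G_{m+1} = G_m` otherwise. -/
def KonigProc {n : ℕ} (σ : EdgeOrdering n) : ℕ → SimpleGraph (Fin n)
  | 0 => ⊥
  | m+1 =>
    if h : m < n*(n-1)/2 then
      (if IsKonig (KonigProc σ m ⊔ SimpleGraph.fromEdgeSet {σ.1 ⟨m, h⟩})
        then KonigProc σ m ⊔ SimpleGraph.fromEdgeSet {σ.1 ⟨m, h⟩}
        else KonigProc σ m)
    else KonigProc σ m

/-- The probability of an event `A` under the uniformly random edge ordering. -/
def Pr (n : ℕ) (A : EdgeOrdering n → Prop) : ℝ :=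
  (Nat.card {σ : EdgeOrdering n // A σ} : ℝ) / (Nat.card (EdgeOrdering n) : ℝ)

/-- `D(G)`: the set of vertices belonging to at least one minimum vertex cover of `G`. -/
def minCoverUnion {n : ℕ} (G : SimpleGraph (Fin n)) : Finset (Fin n) :=
  Finset.univ.filter (fun v =>
    ∃ C : Finset (Fin n), IsVertexCover G C ∧ C.card = coverNum G ∧ v ∈ C)

open Finset

/-! ### Matchings, covers and the König process -/

theorem IsMatchingOn.card_mul_two {n : ℕ} {G : SimpleGraph (Fin n)} {M : Finset (Sym2 (Fin n))}
    (hM : IsMatchingOn G M) : (M.biUnion Sym2.toFinset).card = 2 * M.card := by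
  rw [card_biUnion, sum_congr rfl (fun e he => Sym2.card_toFinset_of_not_isDiag e
    (G.not_isDiag_of_mem_edgeSet (hM.1 e he))), sum_const, smul_eq_mul, mul_comm]
  intro e he f hf hef
  refine disjoint_left.2 fun v hv => ?_
  simpa using hM.2 e he f hf hef v (by simpa using hv)

theorem IsMatchingOn.card_mul_two_le {n : ℕ} {G : SimpleGraph (Fin n)}
    {M : Finset (Sym2 (Fin n))} (hM : IsMatchingOn G M) : 2 * M.card ≤ n := by
  rw [← hM.card_mul_two]
  simpa using card_le_univ (M.biUnion Sym2.toFinset)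

theorem bddAbove_matching_card {n : ℕ} (G : SimpleGraph (Fin n)) :
    BddAbove {k | ∃ M : Finset (Sym2 (Fin n)), IsMatchingOn G M ∧ M.card = k} := by
  refine ⟨n, ?_⟩
  rintro k ⟨M, hM, rfl⟩
  have := hM.card_mul_two_le
  omega

theorem exists_isMatchingOn_card_eq {n : ℕ} (G : SimpleGraph (Fin n)) :
    ∃ M : Finset (Sym2 (Fin n)), IsMatchingOn G M ∧ M.card = matchNum G :=
  Nat.sSup_mem (s := {k | ∃ M : Finset (Sym2 (Fin n)), IsMatchingOn G M ∧ M.card = k})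
    ⟨0, ∅, by simp [IsMatchingOn]⟩ (bddAbove_matching_card G)

theorem IsMatchingOn.card_le_matchNum {n : ℕ} {G : SimpleGraph (Fin n)}
    {M : Finset (Sym2 (Fin n))} (hM : IsMatchingOn G M) : M.card ≤ matchNum G :=
  le_csSup (bddAbove_matching_card G) ⟨M, hM, rfl⟩

theorem two_mul_matchNum_le {n : ℕ} (G : SimpleGraph (Fin n)) : 2 * matchNum G ≤ n := by
  obtain ⟨M, hM, h⟩ := exists_isMatchingOn_card_eq G
  exact h ▸ hM.card_mul_two_le

theorem exists_isVertexCover_card_eq {n : ℕ} (G : SimpleGraph (Fin n)) :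
    ∃ C : Finset (Fin n), IsVertexCover G C ∧ C.card = coverNum G := by
  refine Nat.sInf_mem (s := {k | ∃ C : Finset (Fin n), IsVertexCover G C ∧ C.card = k})
    ⟨_, univ, ?_, rfl⟩
  intro e _
  induction e with | _ x y => exact ⟨x, by simp⟩

theorem IsVertexCover.coverNum_le {n : ℕ} {G : SimpleGraph (Fin n)} {C : Finset (Fin n)}
    (hC : IsVertexCover G C) : coverNum G ≤ C.card :=
  Nat.sInf_le ⟨C, hC, rfl⟩

theorem matchNum_le_coverNum {n : ℕ} (G : SimpleGraph (Fin n)) : matchNum G ≤ coverNum G := by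
  obtain ⟨M, hM, hMc⟩ := exists_isMatchingOn_card_eq G
  obtain ⟨C, hC, hCc⟩ := exists_isVertexCover_card_eq G
  rw [← hMc, ← hCc]
  have h : ∀ e ∈ M, ∃ v, v ∈ C ∧ v ∈ e := fun e he => hC e (hM.1 e he)
  rcases M.eq_empty_or_nonempty with rfl | ⟨e₀, he₀⟩
  · simp
  have : Nonempty (Fin n) := ⟨(h e₀ he₀).choose⟩
  choose! g hg using h
  refine card_le_card_of_injOn g (fun e he => (hg e he).1) ?_
  intro e he f hf hef
  by_contra hne
  exact hM.2 e he f hf hne (g e) (hg e he).2 (hef ▸ (hg f hf).2)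

theorem matchNum_mono {n : ℕ} {G H : SimpleGraph (Fin n)} (h : G ≤ H) :
    matchNum G ≤ matchNum H := by
  obtain ⟨M, hM, hMc⟩ := exists_isMatchingOn_card_eq G
  rw [← hMc]
  exact IsMatchingOn.card_le_matchNum
    ⟨fun e he => SimpleGraph.edgeSet_mono h (hM.1 e he), hM.2⟩

theorem mem_edgeSet_sup_fromEdgeSet_singleton {n : ℕ} {G : SimpleGraph (Fin n)}
    {e f : Sym2 (Fin n)} (he : ¬ e.IsDiag) :
    f ∈ (G ⊔ SimpleGraph.fromEdgeSet {e}).edgeSet ↔ f ∈ G.edgeSet ∨ f = e := by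
  rw [SimpleGraph.edgeSet_sup, SimpleGraph.edgeSet_fromEdgeSet]
  constructor
  · rintro (h | h)
    · exact Or.inl h
    · exact Or.inr h.1
  · rintro (h | rfl)
    · exact Or.inl h
    · exact Or.inr ⟨rfl, he⟩

theorem isKonig_bot (n : ℕ) : IsKonig (⊥ : SimpleGraph (Fin n)) := by
  refine le_antisymm (matchNum_le_coverNum _) ?_
  refine le_trans (IsVertexCover.coverNum_le (C := ∅) ?_) (Nat.zero_le _)
  simp [IsVertexCover]

/-- An edge meeting some minimum vertex cover keeps a König graph König. -/
theorem IsKonig.sup_of_mem_minCoverUnion {n : ℕ} {G : SimpleGraph (Fin n)} (hG : IsKonig G)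
    {e : Sym2 (Fin n)} (he : ¬ e.IsDiag) {v : Fin n} (hve : v ∈ e) (hv : v ∈ minCoverUnion G) :
    IsKonig (G ⊔ SimpleGraph.fromEdgeSet {e}) := by
  obtain ⟨C, hC, hCc, hvC⟩ := (mem_filter.1 hv).2
  refine le_antisymm (matchNum_le_coverNum _) ?_
  have hC' : IsVertexCover (G ⊔ SimpleGraph.fromEdgeSet {e}) C := by
    intro f hf
    rcases (mem_edgeSet_sup_fromEdgeSet_singleton he).1 hf with h | rfl
    · exact hC f h
    · exact ⟨v, hvC, hve⟩
  calc _ ≤ C.card := hC'.coverNum_le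
    _ = matchNum G := by rw [hCc, hG]
    _ ≤ _ := matchNum_mono le_sup_left

/-- The vertices missed by a fixed maximum matching. -/
def missedSet {n : ℕ} (G : SimpleGraph (Fin n)) : Finset (Fin n) :=
  ((exists_isMatchingOn_card_eq G).choose.biUnion Sym2.toFinset)ᶜ

theorem card_missedSet {n : ℕ} (G : SimpleGraph (Fin n)) :
    (missedSet G).card + 2 * matchNum G = n := by
  obtain ⟨hM, hMc⟩ := (exists_isMatchingOn_card_eq G).choose_spec
  have h1 := hM.card_mul_two
  have h2 := hM.card_mul_two_le
  rw [missedSet, card_compl, Fintype.card_fin, h1]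
  omega

/-- An edge joining two vertices missed by a maximum matching is augmenting. -/
theorem matchNum_lt_of_mem_missedSet {n : ℕ} {G : SimpleGraph (Fin n)}
    {e : Sym2 (Fin n)} (he : ¬ e.IsDiag) (h : e ∈ (missedSet G).sym2) :
    matchNum G + 1 ≤ matchNum (G ⊔ SimpleGraph.fromEdgeSet {e}) := by
  obtain ⟨hM, hMc⟩ := (exists_isMatchingOn_card_eq G).choose_spec
  rw [mem_sym2_iff] at h
  have hmiss : ∀ v ∈ e, ∀ f ∈ (exists_isMatchingOn_card_eq G).choose, v ∉ f := by
    intro v hv f hf hvf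
    have := h v hv
    rw [missedSet, mem_compl, mem_biUnion] at this
    exact this ⟨f, hf, by simpa using hvf⟩
  set M := (exists_isMatchingOn_card_eq G).choose
  have heM : e ∉ M := by
    intro heM
    induction e with | _ x y => exact hmiss x (by simp) _ heM (by simp)
  rw [← hMc, ← card_insert_of_notMem heM]
  apply IsMatchingOn.card_le_matchNum
  refine ⟨?_, ?_⟩
  · intro f hf
    rw [mem_edgeSet_sup_fromEdgeSet_singleton he]
    rcases mem_insert.1 hf with rfl | hf
    · exact Or.inr rfl
    · exact Or.inl (hM.1 f hf)
  · intro f hf g hg hfg v hvf hvg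
    rcases mem_insert.1 hf with rfl | hf' <;> rcases mem_insert.1 hg with rfl | hg'
    · exact hfg rfl
    · exact hmiss v hvf g hg' hvg
    · exact hmiss v hvg f hf' hvf
    · exact hM.2 f hf' g hg' hfg v hvf hvg

theorem IsKonig.sup_of_mem_missedSet {n : ℕ} {G : SimpleGraph (Fin n)} (hG : IsKonig G)
    {e : Sym2 (Fin n)} (he : ¬ e.IsDiag) (h : e ∈ (missedSet G).sym2) :
    IsKonig (G ⊔ SimpleGraph.fromEdgeSet {e}) := by
  refine le_antisymm (matchNum_le_coverNum _) ?_
  refine le_trans ?_ (matchNum_lt_of_mem_missedSet he h)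
  obtain ⟨C, hC, hCc⟩ := exists_isVertexCover_card_eq G
  obtain ⟨v, hv⟩ : ∃ v, v ∈ e := by
    induction e with | _ x y => exact ⟨x, by simp⟩
  rw [hG, ← hCc]
  refine le_trans (IsVertexCover.coverNum_le (C := insert v C) ?_) (card_insert_le _ _)
  intro f hf
  rcases (mem_edgeSet_sup_fromEdgeSet_singleton he).1 hf with h | rfl
  · obtain ⟨w, hw, hwf⟩ := hC f h
    exact ⟨w, mem_insert_of_mem hw, hwf⟩
  · exact ⟨v, mem_insert_self _ _, hv⟩

theorem IsKonig.matchNum_le_card_minCoverUnion {n : ℕ} {G : SimpleGraph (Fin n)}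
    (hG : IsKonig G) : matchNum G ≤ (minCoverUnion G).card := by
  obtain ⟨C, hC, hCc⟩ := exists_isVertexCover_card_eq G
  rw [hG, ← hCc]
  exact card_le_card fun v hv => mem_filter.2 ⟨mem_univ _, C, hC, hCc, hv⟩

theorem KonigProc_succ {n : ℕ} (σ : EdgeOrdering n) {m : ℕ} (h : m < n * (n - 1) / 2) :
    KonigProc σ (m + 1) =
      if IsKonig (KonigProc σ m ⊔ SimpleGraph.fromEdgeSet {σ.1 ⟨m, h⟩})
        then KonigProc σ m ⊔ SimpleGraph.fromEdgeSet {σ.1 ⟨m, h⟩}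
        else KonigProc σ m := by
  rw [KonigProc, dif_pos h]

theorem isKonig_KonigProc {n : ℕ} (σ : EdgeOrdering n) (m : ℕ) : IsKonig (KonigProc σ m) := by
  induction m with
  | zero => exact isKonig_bot n
  | succ m ih =>
    rw [KonigProc]
    split_ifs <;> assumption

theorem KonigProc_mono {n : ℕ} (σ : EdgeOrdering n) : Monotone (KonigProc σ) := by
  refine monotone_nat_of_le_succ fun m => ?_
  rw [KonigProc]
  split_ifs
  · exact le_sup_left
  · exact le_rfl
  · exact le_rfl

/-- The process up to time `t` only depends on the first `t` edges. -/
theorem KonigProc_congr {n : ℕ} {σ τ : EdgeOrdering n} {t : ℕ}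
    (h : ∀ i : Fin (n * (n - 1) / 2), (i : ℕ) < t → σ.1 i = τ.1 i) :
    KonigProc σ t = KonigProc τ t := by
  induction t with
  | zero => rfl
  | succ t ih =>
    have ih' := ih fun i hi => h i (by omega)
    rw [KonigProc, KonigProc, ih']
    by_cases ht : t < n * (n - 1) / 2
    · rw [dif_pos ht, dif_pos ht, h ⟨t, ht⟩ (by simp)]
    · rw [dif_neg ht, dif_neg ht]

/-! ### Uniform edge orderings -/

/-- The edges of the complete graph. -/
def allEdges (n : ℕ) : Finset (Sym2 (Fin n)) := univ.filter fun e => ¬ e.IsDiag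

theorem card_allEdges_inter_sym2 {n : ℕ} (S : Finset (Fin n)) :
    ((allEdges n).filter fun e => e ∈ S.sym2).card = S.card.choose 2 := by
  rw [← Sym2.card_image_offDiag]
  congr 1
  ext e
  induction e with | _ x y =>
  simp only [allEdges, mem_filter, mem_univ, true_and, mem_image, mem_offDiag, Prod.exists,
    mk_mem_sym2_iff, Sym2.mk_isDiag_iff]
  constructor
  · rintro ⟨h1, h2, h3⟩
    exact ⟨x, y, ⟨h2, h3, h1⟩, rfl⟩
  · rintro ⟨a, b, ⟨h1, h2, h3⟩, h⟩
    rcases Sym2.eq_iff.1 h with ⟨rfl, rfl⟩ | ⟨rfl, rfl⟩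
    · exact ⟨h3, h1, h2⟩
    · exact ⟨Ne.symm h3, h2, h1⟩

theorem card_allEdges (n : ℕ) : (allEdges n).card = n * (n - 1) / 2 := by
  have h := card_allEdges_inter_sym2 (univ : Finset (Fin n))
  simpa [Nat.choose_two_right] using h

instance finiteEdgeOrdering (n : ℕ) : Finite (EdgeOrdering n) := by
  unfold EdgeOrdering
  infer_instance

instance fintypeEdgeOrdering (n : ℕ) : Fintype (EdgeOrdering n) := Fintype.ofFinite _

instance nonemptyEdgeOrdering (n : ℕ) : Nonempty (EdgeOrdering n) := by
  have e := (allEdges n).equivFinOfCardEq (card_allEdges n)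
  refine ⟨⟨fun i => (e.symm i).1, ?_, fun i => (mem_filter.1 (e.symm i).2).2⟩⟩
  exact Subtype.val_injective.comp e.symm.injective

/-- The ordering with the edges in positions `i` and `j` exchanged. -/
def EdgeOrdering.swap {n : ℕ} (i j : Fin (n * (n - 1) / 2)) (σ : EdgeOrdering n) :
    EdgeOrdering n :=
  ⟨fun a => σ.1 (Equiv.swap i j a), σ.2.1.comp (Equiv.swap i j).injective, fun _ => σ.2.2 _⟩

theorem EdgeOrdering.swap_swap {n : ℕ} (i j : Fin (n * (n - 1) / 2)) :
    Function.Involutive (EdgeOrdering.swap (n := n) i j) := by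
  intro σ
  apply Subtype.ext
  funext a
  simp [EdgeOrdering.swap]

/-- The value of `f` at the current graph and the edge offered at step `i`. -/
def stepValue {n : ℕ} (f : SimpleGraph (Fin n) → Sym2 (Fin n) → ℝ) (σ : EdgeOrdering n)
    (i : ℕ) : ℝ :=
  if h : i < n * (n - 1) / 2 then f (KonigProc σ i) (σ.1 ⟨i, h⟩) else 0

theorem EdgeOrdering.sum_le {n : ℕ} (σ : EdgeOrdering n) {g : Sym2 (Fin n) → ℝ}
    (hg : ∀ e, 0 ≤ g e) (s : Finset (Fin (n * (n - 1) / 2))) :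
    ∑ j ∈ s, g (σ.1 j) ≤ ∑ e ∈ allEdges n, g e := by
  rw [← sum_image (f := g) (fun a _ b _ h => σ.2.1 h)]
  refine sum_le_sum_of_subset_of_nonneg ?_ fun e _ _ => hg e
  intro e he
  obtain ⟨j, _, rfl⟩ := mem_image.1 he
  exact mem_filter.2 ⟨mem_univ _, σ.2.2 j⟩

theorem sum_prod_stepValue_succ_le {n : ℕ} {w : SimpleGraph (Fin n) → Sym2 (Fin n) → ℝ}
    (hw : ∀ G e, 0 ≤ w G e) {B : ℝ} (hB : ∀ G, ∑ e ∈ allEdges n, w G e ≤ B) {t : ℕ}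
    (ht : t < n * (n - 1) / 2) :
    (((n * (n - 1) / 2 : ℕ) : ℝ) - t) * ∑ σ : EdgeOrdering n, ∏ i ∈ range (t + 1), stepValue w σ i
      ≤ B * ∑ σ : EdgeOrdering n, ∏ i ∈ range t, stepValue w σ i := by
  have hnn : ∀ (σ : EdgeOrdering n) (i : ℕ), 0 ≤ stepValue w σ i := by
    intro σ i
    unfold stepValue
    split_ifs
    · exact hw _ _
    · exact le_rfl
  have hswap : ∀ j ∈ Ici (⟨t, ht⟩ : Fin (n * (n - 1) / 2)),
      ∑ σ : EdgeOrdering n, ∏ i ∈ range (t + 1), stepValue w σ i =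
        ∑ σ : EdgeOrdering n, (∏ i ∈ range t, stepValue w σ i) * w (KonigProc σ t) (σ.1 j) := by
    intro j hj
    have hj' : t ≤ (j : ℕ) := by simpa [Fin.le_def] using hj
    refine Fintype.sum_bijective _ (EdgeOrdering.swap_swap ⟨t, ht⟩ j).bijective _ _ fun σ => ?_
    have hpre : ∀ s ≤ t, ∀ i : Fin (n * (n - 1) / 2), (i : ℕ) < s →
        σ.1 i = (EdgeOrdering.swap ⟨t, ht⟩ j σ).1 i := by
      intro s hs i hi
      simp only [EdgeOrdering.swap]
      rw [Equiv.swap_apply_of_ne_of_ne]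
      · rintro rfl
        simp at hi
        omega
      · rintro rfl
        omega
    rw [prod_range_succ]
    congr 1
    · refine prod_congr rfl fun i hi => ?_
      have hi' := mem_range.1 hi
      have hiN : i < n * (n - 1) / 2 := by omega
      rw [stepValue, stepValue, dif_pos hiN, dif_pos hiN,
        KonigProc_congr (hpre i (by omega)), hpre t le_rfl ⟨i, hiN⟩ hi']
    · rw [stepValue, dif_pos ht, KonigProc_congr (hpre t le_rfl)]
      simp [EdgeOrdering.swap]
  have hsum := sum_congr rfl hswap
  rw [sum_const, Fin.card_Ici, nsmul_eq_mul, Nat.cast_sub ht.le, sum_comm] at hsum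
  rw [hsum, mul_sum]
  refine sum_le_sum fun σ _ => ?_
  rw [← mul_sum, mul_comm B]
  refine mul_le_mul_of_nonneg_left ?_ (prod_nonneg fun i _ => hnn σ i)
  exact (σ.sum_le (hw _) _).trans (hB _)

theorem sum_prod_stepValue_le {n : ℕ} {w : SimpleGraph (Fin n) → Sym2 (Fin n) → ℝ}
    (hw : ∀ G e, 0 ≤ w G e) {B : ℝ} (hB : ∀ G, ∑ e ∈ allEdges n, w G e ≤ B) {M : ℕ}
    (hM : M < n * (n - 1) / 2) :
    ∑ σ : EdgeOrdering n, ∏ i ∈ range M, stepValue w σ i ≤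
      (B / (((n * (n - 1) / 2 : ℕ) : ℝ) - M)) ^ M * Fintype.card (EdgeOrdering n) := by
  have hB0 : 0 ≤ B := (sum_nonneg fun e _ => hw ⊥ e).trans (hB ⊥)
  have hpos : (0 : ℝ) < ((n * (n - 1) / 2 : ℕ) : ℝ) - M := sub_pos.2 (by exact_mod_cast hM)
  suffices h : ∀ t ≤ M, ∑ σ : EdgeOrdering n, ∏ i ∈ range t, stepValue w σ i ≤
      (B / (((n * (n - 1) / 2 : ℕ) : ℝ) - M)) ^ t * Fintype.card (EdgeOrdering n) from h M le_rfl
  intro t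
  induction t with
  | zero => simp
  | succ t ih =>
    intro ht
    have h1 := sum_prod_stepValue_succ_le hw hB (t := t) (by omega)
    have hS : 0 ≤ ∑ σ : EdgeOrdering n, ∏ i ∈ range (t + 1), stepValue w σ i := by
      refine sum_nonneg fun σ _ => prod_nonneg fun i _ => ?_
      unfold stepValue
      split_ifs
      · exact hw _ _
      · exact le_rfl
    have htM : (t : ℝ) ≤ M := by exact_mod_cast (by omega : t ≤ M)
    rw [pow_succ, mul_comm (_ ^ t), mul_assoc, div_mul_eq_mul_div, le_div_iff₀ hpos]
    calc _ ≤ (((n * (n - 1) / 2 : ℕ) : ℝ) - t) *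
            ∑ σ : EdgeOrdering n, ∏ i ∈ range (t + 1), stepValue w σ i := by
          rw [mul_comm]
          gcongr
      _ ≤ _ := h1
      _ ≤ _ := mul_le_mul_of_nonneg_left (ih (by omega)) hB0

theorem sum_exp_mul_le {ι : Type*} {s : Finset ι} {c : ι → ℝ} (hc : ∀ i, |c i| ≤ 2)
    (hsum : ∑ i ∈ s, c i = 0) {r : ℝ} (hr : 0 ≤ r) (hr' : r ≤ 1 / 2) :
    ∑ i ∈ s, Real.exp (r * c i) ≤ s.card * Real.exp (4 * r ^ 2) := by
  have hterm : ∀ i ∈ s, Real.exp (r * c i) ≤ 1 + r * c i + 4 * r ^ 2 := by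
    intro i _
    have hci := abs_le.1 (hc i)
    have h1 : |r * c i| ≤ 1 := by
      rw [abs_mul, abs_of_nonneg hr]
      nlinarith [hc i, abs_nonneg (c i)]
    have h2 := (abs_le.1 (Real.abs_exp_sub_one_sub_id_le h1)).2
    have h3 : c i ^ 2 ≤ 4 := by nlinarith
    nlinarith [sq_nonneg r, mul_le_mul_of_nonneg_left h3 (sq_nonneg r)]
  calc _ ≤ ∑ i ∈ s, (1 + r * c i + 4 * r ^ 2) := sum_le_sum hterm
    _ = s.card * (1 + 4 * r ^ 2) := by
      rw [sum_add_distrib, sum_add_distrib, ← mul_sum, hsum]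
      simp
      ring
    _ ≤ _ := by
      gcongr
      linarith [Real.add_one_le_exp (4 * r ^ 2)]

/-- Exponential concentration for sums of centred functions of the current graph and the edge
offered next. -/
theorem card_le_sum_stepValue_le {n : ℕ} {c : SimpleGraph (Fin n) → Sym2 (Fin n) → ℝ}
    (hc : ∀ G e, |c G e| ≤ 2) (hsum : ∀ G, ∑ e ∈ allEdges n, c G e = 0) {r : ℝ} (hr : 0 ≤ r)
    (hr' : r ≤ 1 / 2) {M : ℕ} (hM : M < n * (n - 1) / 2) (x : ℝ) :
    ((univ.filter fun σ : EdgeOrdering n => x ≤ ∑ i ∈ range M, stepValue c σ i).card : ℝ) ≤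
      Real.exp (4 * r ^ 2 * M - r * x +
        (M : ℝ) ^ 2 / (((n * (n - 1) / 2 : ℕ) : ℝ) - M)) * Fintype.card (EdgeOrdering n) := by
  set N : ℝ := ((n * (n - 1) / 2 : ℕ) : ℝ) with hN
  have hpos : 0 < N - M := sub_pos.2 (by rw [hN]; exact_mod_cast hM)
  have hmain := sum_prod_stepValue_le (w := fun G e => Real.exp (r * c G e))
    (B := N * Real.exp (4 * r ^ 2)) (fun G e => (Real.exp_pos _).le)
    (fun G => by
      have h := sum_exp_mul_le (hc G) (hsum G) hr hr'
      rwa [card_allEdges] at h) hM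
  rw [← hN] at hmain
  have hprod : ∀ σ : EdgeOrdering n,
      ∏ i ∈ range M, stepValue (fun G e => Real.exp (r * c G e)) σ i =
        Real.exp (r * ∑ i ∈ range M, stepValue c σ i) := by
    intro σ
    rw [mul_sum, Real.exp_sum]
    refine prod_congr rfl fun i hi => ?_
    have hi' : i < n * (n - 1) / 2 := (mem_range.1 hi).trans hM
    rw [stepValue, stepValue, dif_pos hi', dif_pos hi']
  simp only [hprod] at hmain
  have hmarkov : (univ.filter fun σ : EdgeOrdering n =>
      x ≤ ∑ i ∈ range M, stepValue c σ i).card * Real.exp (r * x) ≤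
        ∑ σ : EdgeOrdering n, Real.exp (r * ∑ i ∈ range M, stepValue c σ i) := by
    rw [← nsmul_eq_mul, ← sum_const]
    calc _ ≤ ∑ σ ∈ univ.filter fun σ : EdgeOrdering n =>
            x ≤ ∑ i ∈ range M, stepValue c σ i,
              Real.exp (r * ∑ i ∈ range M, stepValue c σ i) := by
          refine sum_le_sum fun σ hσ => Real.exp_le_exp.2 ?_
          exact mul_le_mul_of_nonneg_left (mem_filter.1 hσ).2 hr
      _ ≤ _ := sum_le_sum_of_subset_of_nonneg (filter_subset _ _)
          fun _ _ _ => (Real.exp_pos _).le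
  have hpow : (N * Real.exp (4 * r ^ 2) / (N - M)) ^ M ≤
      Real.exp (4 * r ^ 2 * M + (M : ℝ) ^ 2 / (N - M)) := by
    have h1 : N / (N - M) ≤ Real.exp (M / (N - M)) := by
      have h2 : N / (N - M) = M / (N - M) + 1 := by
        field_simp
        ring
      rw [h2]
      exact Real.add_one_le_exp _
    calc _ = (N / (N - M) * Real.exp (4 * r ^ 2)) ^ M := by ring
      _ ≤ (Real.exp (M / (N - M)) * Real.exp (4 * r ^ 2)) ^ M := by
        have : 0 ≤ N / (N - M) := div_nonneg (by positivity) hpos.le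
        gcongr
      _ = _ := by
        rw [← Real.exp_add, ← Real.exp_nat_mul]
        congr 1
        ring
  have h := hmarkov.trans (hmain.trans (mul_le_mul_of_nonneg_right hpow (Nat.cast_nonneg _)))
  rw [← le_div_iff₀ (Real.exp_pos _)] at h
  refine h.trans_eq ?_
  rw [mul_div_right_comm, ← Real.exp_sub]
  congr 2
  ring

/-- The centred indicator that an edge lies inside `S`. -/
def insideDev {n : ℕ} (S : Finset (Fin n)) (e : Sym2 (Fin n)) : ℝ :=
  (if e ∈ S.sym2 then 1 else 0) - (S.card.choose 2 : ℝ) / ((n * (n - 1) / 2 : ℕ) : ℝ)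

theorem sum_insideDev {n : ℕ} (S : Finset (Fin n)) : ∑ e ∈ allEdges n, insideDev S e = 0 := by
  unfold insideDev
  rw [sum_sub_distrib, sum_boole, card_allEdges_inter_sym2, sum_const, card_allEdges, nsmul_eq_mul]
  have hle : S.card.choose 2 ≤ n * (n - 1) / 2 := by
    rw [← card_allEdges_inter_sym2, ← card_allEdges]
    exact card_filter_le _ _
  rcases Nat.eq_zero_or_pos (n * (n - 1) / 2) with h | h
  · rw [h] at hle
    simp [h, Nat.le_zero.1 hle]
  · rw [mul_div_cancel₀, sub_self]
    exact_mod_cast h.ne'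

theorem abs_insideDev_le {n : ℕ} (S : Finset (Fin n)) (e : Sym2 (Fin n)) :
    |insideDev S e| ≤ 1 := by
  have hle : (S.card.choose 2 : ℝ) ≤ ((n * (n - 1) / 2 : ℕ) : ℝ) := by
    rw [← card_allEdges_inter_sym2, ← card_allEdges]
    exact_mod_cast card_filter_le _ _
  have h1 := div_le_one_of_le₀ hle (Nat.cast_nonneg _)
  have h0 : 0 ≤ (S.card.choose 2 : ℝ) / ((n * (n - 1) / 2 : ℕ) : ℝ) := by positivity
  unfold insideDev
  rw [abs_le]
  split_ifs <;> constructor <;> linarith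

/-- Compares the edges outside the minimum vertex covers of `G` with those outside `C`. -/
def coverDev {n : ℕ} (C : Finset (Fin n)) (G : SimpleGraph (Fin n)) (e : Sym2 (Fin n)) : ℝ :=
  insideDev (minCoverUnion G)ᶜ e - insideDev Cᶜ e

/-- The centred indicator that an edge does not join two vertices missed by a maximum matching. -/
def missedDev {n : ℕ} (G : SimpleGraph (Fin n)) (e : Sym2 (Fin n)) : ℝ :=
  -insideDev (missedSet G) e

/-- The orderings along which one of the deviations reaches `x` within `M` steps are rare. -/
theorem card_exists_deviation_le {n : ℕ} {r : ℝ} (hr : 0 ≤ r) (hr' : r ≤ 1 / 2) {M : ℕ}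
    (hM : M < n * (n - 1) / 2) (x : ℝ) :
    ((univ.filter fun σ : EdgeOrdering n =>
        (∃ C, x ≤ ∑ i ∈ range M, stepValue (coverDev C) σ i) ∨
          x ≤ ∑ i ∈ range M, stepValue missedDev σ i).card : ℝ) ≤
      (2 ^ n + 1) * Real.exp (4 * r ^ 2 * M - r * x +
        (M : ℝ) ^ 2 / (((n * (n - 1) / 2 : ℕ) : ℝ) - M)) * Fintype.card (EdgeOrdering n) := by
  set b := Real.exp (4 * r ^ 2 * M - r * x +
        (M : ℝ) ^ 2 / (((n * (n - 1) / 2 : ℕ) : ℝ) - M)) * Fintype.card (EdgeOrdering n) with hb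
  have h1 : ∀ C : Finset (Fin n), ((univ.filter fun σ : EdgeOrdering n =>
      x ≤ ∑ i ∈ range M, stepValue (coverDev C) σ i).card : ℝ) ≤ b := fun C => by
    refine card_le_sum_stepValue_le (fun G e => ?_) (fun G => ?_) hr hr' hM x
    · refine (abs_sub _ _).trans ?_
      linarith [abs_insideDev_le (minCoverUnion G)ᶜ e, abs_insideDev_le Cᶜ e]
    · simp [coverDev, sum_sub_distrib, sum_insideDev]
  have h2 : ((univ.filter fun σ : EdgeOrdering n =>
      x ≤ ∑ i ∈ range M, stepValue missedDev σ i).card : ℝ) ≤ b := by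
    refine card_le_sum_stepValue_le (fun G e => ?_) (fun G => ?_) hr hr' hM x
    · rw [missedDev, abs_neg]
      linarith [abs_insideDev_le (missedSet G) e]
    · simp [missedDev, sum_insideDev]
  have h3 : (univ.filter fun σ : EdgeOrdering n =>
      (∃ C, x ≤ ∑ i ∈ range M, stepValue (coverDev C) σ i) ∨
        x ≤ ∑ i ∈ range M, stepValue missedDev σ i) =
      ((univ : Finset (Finset (Fin n))).biUnion fun C => univ.filter fun σ : EdgeOrdering n =>
        x ≤ ∑ i ∈ range M, stepValue (coverDev C) σ i) ∪
      univ.filter fun σ : EdgeOrdering n => x ≤ ∑ i ∈ range M, stepValue missedDev σ i := by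
    ext σ
    simp
  rw [h3, mul_assoc, ← hb]
  calc _ ≤ (((∑ C : Finset (Fin n), (univ.filter fun σ : EdgeOrdering n =>
          x ≤ ∑ i ∈ range M, stepValue (coverDev C) σ i).card) +
        (univ.filter fun σ : EdgeOrdering n =>
          x ≤ ∑ i ∈ range M, stepValue missedDev σ i).card : ℕ) : ℝ) := by
        exact_mod_cast (card_union_le _ _).trans (Nat.add_le_add_right card_biUnion_le _)
    _ ≤ (∑ _C : Finset (Fin n), b) + b := by
        push_cast
        exact add_le_add (sum_le_sum fun C _ => h1 C) h2
    _ = _ := by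
        simp
        ring

/-! ### Counting the steps with many unfrozen vertices -/

/-- Along the process, edges outside all minimum covers include those outside the final cover. -/
theorem sum_choose_sub_le_stepValue {n : ℕ} (σ : EdgeOrdering n) {M : ℕ}
    (hM : M < n * (n - 1) / 2) {C : Finset (Fin n)} (hC : IsVertexCover (KonigProc σ M) C) :
    ∑ i ∈ range M, (((n - C.card).choose 2 : ℝ) -
        ((n - (minCoverUnion (KonigProc σ i)).card).choose 2 : ℝ)) /
          ((n * (n - 1) / 2 : ℕ) : ℝ) ≤
      ∑ i ∈ range M, stepValue (coverDev C) σ i := by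
  refine sum_le_sum fun i hi => ?_
  have hiM := mem_range.1 hi
  have hiN := hiM.trans hM
  rw [stepValue, dif_pos hiN, coverDev, insideDev, insideDev, card_compl, card_compl,
    Fintype.card_fin, sub_div]
  suffices h : σ.1 ⟨i, hiN⟩ ∈ Cᶜ.sym2 → σ.1 ⟨i, hiN⟩ ∈ (minCoverUnion (KonigProc σ i))ᶜ.sym2 by
    split_ifs with h1 h2 h2
    · linarith
    · linarith
    · exact absurd (h h2) h1
    · linarith
  intro h
  rw [mem_sym2_iff] at h ⊢
  intro v hv
  rw [mem_compl]
  intro hvD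
  have hnd := σ.2.2 ⟨i, hiN⟩
  have hsucc := KonigProc_succ σ hiN
  rw [if_pos ((isKonig_KonigProc σ i).sup_of_mem_minCoverUnion hnd hv hvD)] at hsucc
  have hmem : σ.1 ⟨i, hiN⟩ ∈ (KonigProc σ M).edgeSet := by
    refine SimpleGraph.edgeSet_mono (KonigProc_mono σ (Nat.succ_le_of_lt hiM)) ?_
    rw [Nat.succ_eq_add_one, hsucc]
    exact (mem_edgeSet_sup_fromEdgeSet_singleton hnd).2 (Or.inr rfl)
  obtain ⟨w, hwC, hw⟩ := hC _ hmem
  exact mem_compl.1 (h w hw) hwC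

/-- Every edge joining two missed vertices increases the matching number. -/
theorem sum_choose_missedSet_le {n : ℕ} (σ : EdgeOrdering n) {M : ℕ}
    (hM : M < n * (n - 1) / 2) :
    ∑ i ∈ range M, ((missedSet (KonigProc σ i)).card.choose 2 : ℝ) /
        ((n * (n - 1) / 2 : ℕ) : ℝ) ≤
      matchNum (KonigProc σ M) + ∑ i ∈ range M, stepValue missedDev σ i := by
  induction M with
  | zero => simp
  | succ M ih =>
    have hMN : M < n * (n - 1) / 2 := by omega
    rw [sum_range_succ, sum_range_succ]
    have ih' := ih hMN
    have hnd := σ.2.2 ⟨M, hMN⟩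
    have hmono : (matchNum (KonigProc σ M) : ℝ) ≤ matchNum (KonigProc σ (M + 1)) := by
      exact_mod_cast matchNum_mono (KonigProc_mono σ (Nat.le_succ M))
    rw [stepValue, dif_pos hMN, missedDev, insideDev]
    split_ifs with h
    · have hsucc := KonigProc_succ σ hMN
      rw [if_pos ((isKonig_KonigProc σ M).sup_of_mem_missedSet hnd h)] at hsucc
      have h1 : (matchNum (KonigProc σ M) : ℝ) + 1 ≤ matchNum (KonigProc σ (M + 1)) := by
        rw [hsucc]
        exact_mod_cast matchNum_lt_of_mem_missedSet hnd h
      linarith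
    · linarith

theorem cast_two_mul_choose_two (k : ℕ) :
    (((2 * k) * (2 * k - 1) / 2 : ℕ) : ℝ) = k * (2 * k - 1) := by
  rw [← Nat.choose_two_right, Nat.cast_choose_two]
  push_cast
  ring

theorem choose_sub_choose_div_ge {k c D ν d : ℕ} (hk : 2 ≤ k) (hc : c ≤ k) (hD : D ≤ 2 * k)
    (hν : ν ≤ D) (hd : d + 2 * ν = 2 * k) {ε : ℝ} (hε : 0 ≤ ε) :
    (if (1 / 2 + ε) * (2 * k) < D then ε / 3 else 0) - d / (2 * k) ≤
      (((2 * k - c).choose 2 : ℝ) - ((2 * k - D).choose 2 : ℝ)) /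
        (((2 * k) * (2 * k - 1) / 2 : ℕ) : ℝ) := by
  have hk' : (2 : ℝ) ≤ k := by exact_mod_cast hk
  have hchoose : ((k.choose 2 : ℕ) : ℝ) ≤ ((2 * k - c).choose 2 : ℕ) := by
    exact_mod_cast Nat.choose_le_choose 2 (by omega)
  rw [Nat.cast_choose_two] at hchoose
  have hb : (((2 * k - D).choose 2 : ℕ) : ℝ) = (2 * k - D) * (2 * k - D - 1) / 2 := by
    rw [Nat.cast_choose_two, Nat.cast_sub hD]
    push_cast
    ring
  have hD' : (D : ℝ) ≤ 2 * k := by exact_mod_cast hD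
  have hdr : (d : ℝ) + 2 * ν = 2 * k := by exact_mod_cast hd
  have hνr : (ν : ℝ) ≤ D := by exact_mod_cast hν
  have hd0 : (0 : ℝ) ≤ d := Nat.cast_nonneg d
  have hν0 : (0 : ℝ) ≤ ν := Nat.cast_nonneg ν
  rw [cast_two_mul_choose_two, hb]
  obtain ⟨s, hs⟩ : ∃ s : ℝ, s = D - k := ⟨_, rfl⟩
  have hDs : (D : ℝ) = k + s := by linarith
  have hN : (0 : ℝ) < k * (2 * k - 1) := by nlinarith
  rw [le_div_iff₀ hN]
  have hnum : s * (2 * k - 1 - s) / 2 ≤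
      ((2 * k - c).choose 2 : ℝ) - (2 * k - D) * (2 * k - D - 1) / 2 := by
    rw [hDs]
    nlinarith
  refine le_trans ?_ hnum
  have hdk : (d : ℝ) / (2 * k) * (k * (2 * k - 1)) = d * (2 * k - 1) / 2 := by
    field_simp
  rw [sub_mul, hdk]
  have hd1 : 0 ≤ (d : ℝ) * (2 * k - 1) := mul_nonneg hd0 (by linarith)
  split_ifs with h
  · have hs1 : 2 * ε * k < s := by linarith
    have hs0 : 0 ≤ s := by nlinarith [mul_nonneg hε (by linarith : (0 : ℝ) ≤ k)]
    have h1 : s * ((2 * k - 1) / 3) ≤ s * (2 * k - 1 - s) :=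
      mul_le_mul_of_nonneg_left (by linarith) hs0
    have h2 : 2 * ε * k * (2 * k - 1) ≤ s * (2 * k - 1) :=
      mul_le_mul_of_nonneg_right hs1.le (by linarith)
    nlinarith
  · rcases le_total 0 s with hs0 | hs0
    · have h1 : 0 ≤ s * (2 * k - 1 - s) := mul_nonneg hs0 (by linarith)
      linarith
    · have h1 : s * (2 * (2 * k - 1)) ≤ s * (2 * k - 1 - s) :=
        mul_le_mul_of_nonpos_left (by linarith) hs0
      have h2 : -(d : ℝ) / 2 * (2 * k - 1) ≤ s * (2 * k - 1) :=
        mul_le_mul_of_nonneg_right (by linarith) (by linarith)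
      linarith

theorem div_le_add_choose_div {k d : ℕ} (hk : 2 ≤ k) {η : ℝ} (hη : 0 < η) :
    (d : ℝ) / (2 * k) ≤ 1 / (2 * k) + η +
      ((d.choose 2 : ℝ) / (((2 * k) * (2 * k - 1) / 2 : ℕ) : ℝ)) / η := by
  have hk' : (2 : ℝ) ≤ k := by exact_mod_cast hk
  rw [cast_two_mul_choose_two, Nat.cast_choose_two]
  rcases Nat.eq_zero_or_pos d with rfl | hd
  · simp
    positivity
  have hd' : (1 : ℝ) ≤ d := by exact_mod_cast hd
  obtain ⟨u, hu⟩ : ∃ u : ℝ, u = ((d : ℝ) - 1) / (2 * k) := ⟨_, rfl⟩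
  have hu2 : u ^ 2 ≤ (d : ℝ) * (d - 1) / 2 / (k * (2 * k - 1)) := by
    rw [hu, div_div, div_pow, div_le_div_iff₀ (by positivity) (by nlinarith)]
    have h1 : 0 ≤ ((d : ℝ) - 1) * k := by nlinarith
    have h2 : (0 : ℝ) ≤ d * (2 * k) - (d - 1) * (2 * k - 1) := by nlinarith
    nlinarith [mul_nonneg h1 h2]
  have hu1 : u ≤ η + u ^ 2 / η := by
    rw [← sub_le_iff_le_add', le_div_iff₀ hη]
    nlinarith [sq_nonneg (u - η), sq_nonneg u]
  have hsplit : (d : ℝ) / (2 * k) = 1 / (2 * k) + u := by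
    rw [hu]
    ring
  rw [hsplit, add_assoc]
  gcongr
  exact hu1.trans (by gcongr)

/-- If no deviation reaches `x`, few steps have more than `(1/2 + ε) n` vertices in minimum
covers. -/
theorem card_filter_minCoverUnion_le {k : ℕ} (hk : 2 ≤ k) (σ : EdgeOrdering (2 * k)) {M : ℕ}
    (hM : M < (2 * k) * (2 * k - 1) / 2) {x ε η : ℝ} (hε : 0 ≤ ε) (hη : 0 < η)
    (hcover : ∀ C, ∑ i ∈ range M, stepValue (coverDev C) σ i < x)
    (hmissed : ∑ i ∈ range M, stepValue missedDev σ i < x) :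
    ((range M).filter fun m => (1 / 2 + ε) * (2 * k) <
        ((minCoverUnion (KonigProc σ m)).card : ℝ)).card * (ε / 3) ≤
      x + M * (1 / (2 * k) + η) + (k + x) / η := by
  obtain ⟨C, hC, hCc⟩ := exists_isVertexCover_card_eq (KonigProc σ M)
  have hν := two_mul_matchNum_le (KonigProc σ M)
  have hCk : C.card ≤ k := by
    rw [hCc, ← isKonig_KonigProc σ M]
    omega
  have h1 := (sum_choose_sub_le_stepValue σ hM hC).trans (hcover C).le
  have h2 := sum_choose_missedSet_le σ hM
  have hνk : (matchNum (KonigProc σ M) : ℝ) ≤ k := by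
    exact_mod_cast (by omega : matchNum (KonigProc σ M) ≤ k)
  have h3 := (sum_le_sum fun i (_ : i ∈ range M) => choose_sub_choose_div_ge hk hCk
    (by simpa using card_le_univ (minCoverUnion (KonigProc σ i)))
    (isKonig_KonigProc σ i).matchNum_le_card_minCoverUnion
    (card_missedSet (KonigProc σ i)) hε).trans h1
  have h4 := sum_le_sum fun i (_ : i ∈ range M) =>
    div_le_add_choose_div (d := (missedSet (KonigProc σ i)).card) hk hη
  rw [sum_sub_distrib, ← sum_filter, sum_const, nsmul_eq_mul] at h3
  rw [sum_add_distrib, sum_const, card_range, nsmul_eq_mul] at h4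
  have h5 : (∑ i ∈ range M, ((missedSet (KonigProc σ i)).card.choose 2 : ℝ) /
        (((2 * k) * (2 * k - 1) / 2 : ℕ) : ℝ)) / η ≤ (k + x) / η := by
    gcongr
    linarith
  rw [sum_div] at h5
  linarith

/-! ### Asymptotics -/

theorem one_sub_le_Pr {n : ℕ} {A B : EdgeOrdering n → Prop} [DecidablePred B] {b : ℝ}
    (hB : ((univ.filter B).card : ℝ) ≤ b * Fintype.card (EdgeOrdering n))
    (h : ∀ σ, ¬ B σ → A σ) : 1 - b ≤ Pr n A := by
  have hpos : (0 : ℝ) < Fintype.card (EdgeOrdering n) := by exact_mod_cast Fintype.card_pos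
  rw [Pr, Nat.card_eq_fintype_card, Nat.card_eq_fintype_card, Fintype.card_subtype,
    le_div_iff₀ hpos]
  have h1 : Fintype.card (EdgeOrdering n) ≤ (univ.filter A).card + (univ.filter B).card := by
    rw [← card_univ]
    refine (card_le_card fun σ _ => ?_).trans (card_union_le _ _)
    by_cases hσ : B σ
    · exact mem_union_right _ (by simpa using hσ)
    · exact mem_union_left _ (by simpa using h σ hσ)
  have h2 : (Fintype.card (EdgeOrdering n) : ℝ) ≤
      (univ.filter A).card + (univ.filter B).card := by exact_mod_cast h1
  linarith

theorem Pr_le_one {n : ℕ} (A : EdgeOrdering n → Prop) : Pr n A ≤ 1 := by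
  rw [Pr, Nat.card_eq_fintype_card, Nat.card_eq_fintype_card]
  refine div_le_one_of_le₀ ?_ (Nat.cast_nonneg _)
  exact_mod_cast Fintype.card_subtype_le A

/-- A bound on the total number of steps considered, in terms of `y = (log n)^{1/40}`. -/
theorem ceil_add_floor_le {γ y n : ℝ} (hγ : 0 < γ) (hn : 1 ≤ n) (hy : 1 ≤ y) :
    ((⌈n * y ^ 20⌉₊ + ⌊γ * n * y ^ 40⌋₊ : ℕ) : ℝ) ≤ (γ + 2) * n * y ^ 40 := by
  have hyp : y ^ 20 ≤ y ^ 40 := pow_le_pow_right₀ hy (by norm_num)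
  have hy40 : 1 ≤ y ^ 40 := one_le_pow₀ hy
  have h1 := (Nat.ceil_lt_add_one (by positivity : 0 ≤ n * y ^ 20)).le
  have h2 := Nat.floor_le (by positivity : 0 ≤ γ * n * y ^ 40)
  push_cast
  nlinarith [mul_le_mul_of_nonneg_left hyp (by linarith : 0 ≤ n)]

theorem deviation_exponent_le {K y n N M : ℝ} (hK : 1 ≤ K) (hn : 1 ≤ n) (hy : 1 ≤ y)
    (hyK : 4 * K + 4 ≤ y ^ 2) (hyn : 8 * K ^ 2 * y ^ 80 ≤ n) (hN : n ^ 2 / 4 ≤ N)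
    (hM0 : 0 ≤ M) (hM : M ≤ K * n * y ^ 40) :
    M < N ∧ 4 * ((y ^ 20)⁻¹) ^ 2 * M - (y ^ 20)⁻¹ * (n * y ^ 22) +
      M ^ 2 / (N - M) ≤ -(3 * n) := by
  have hy40 : 1 ≤ y ^ 40 := one_le_pow₀ hy
  have hKy : K * y ^ 40 ≤ K ^ 2 * y ^ 80 := by
    have h1 : 1 ≤ K * y ^ 40 := by nlinarith
    nlinarith
  have hM8 : M ≤ n ^ 2 / 8 := by nlinarith
  have hNM : n ^ 2 / 8 ≤ N - M := by linarith
  have hn2 : 0 < n ^ 2 / 8 := by positivity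
  refine ⟨by linarith, ?_⟩
  have h1 : M ^ 2 / (N - M) ≤ n := by
    rw [div_le_iff₀ (by linarith)]
    have h2 : M ^ 2 ≤ (K * n * y ^ 40) ^ 2 := pow_le_pow_left₀ hM0 hM 2
    have h3 : n * (n ^ 2 / 8) ≤ n * (N - M) := mul_le_mul_of_nonneg_left hNM (by linarith)
    have h4 : n ^ 2 * (8 * K ^ 2 * y ^ 80) ≤ n ^ 2 * n :=
      mul_le_mul_of_nonneg_left hyn (by positivity)
    nlinarith
  have h2 : 4 * ((y ^ 20)⁻¹) ^ 2 * M ≤ 4 * K * n := by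
    calc _ ≤ 4 * ((y ^ 20)⁻¹) ^ 2 * (K * n * y ^ 40) := by gcongr
      _ = _ := by
        field_simp
  have h3 : (y ^ 20)⁻¹ * (n * y ^ 22) = n * y ^ 2 := by
    field_simp
  rw [h3]
  nlinarith

theorem two_pow_add_one_mul_exp_le {n : ℕ} (hn : 1 ≤ n) {a : ℝ} (ha : a ≤ -(3 * n)) :
    (2 ^ n + 1) * Real.exp a ≤ Real.exp (-n) := by
  have hn' : (1 : ℝ) ≤ n := by exact_mod_cast hn
  have h2 : (2 : ℝ) ≤ Real.exp 1 := by linarith [Real.add_one_le_exp 1]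
  have h3 : (2 : ℝ) ^ n + 1 ≤ Real.exp (2 * n) := by
    calc (2 : ℝ) ^ n + 1 ≤ 2 ^ n * 2 := by linarith [one_le_pow₀ (n := n) (one_le_two (α := ℝ))]
      _ ≤ Real.exp n * Real.exp n := by
        have h4 : (2 : ℝ) ^ n ≤ Real.exp n := by
          rw [← mul_one (n : ℝ), Real.exp_nat_mul]
          gcongr
        gcongr
        exact h2.trans (Real.exp_le_exp.2 hn')
      _ = _ := by
        rw [← Real.exp_add]
        ring_nf
  calc _ ≤ Real.exp (2 * n) * Real.exp (-(3 * n)) := by gcongr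
    _ = _ := by
      rw [← Real.exp_add]
      ring_nf

theorem le_of_mul_le_deviation_bound {γ y n κ M c : ℝ} (hγ : 0 < γ) (hn : 1 ≤ n) (hκ : κ ≤ n)
    (hy : 1 ≤ y) (hM : M ≤ (γ + 2) * n * y ^ 40)
    (hyγ : 3 * (2 * (γ + 2) + 3) ≤ γ * y) (hyn : 8 * (γ + 2) ^ 2 * y ^ 80 ≤ n)
    (hc : c * ((y ^ 4)⁻¹ / 3) ≤
      n * y ^ 22 + M * (1 / n + (y ^ 9)⁻¹) + (κ + n * y ^ 22) / (y ^ 9)⁻¹) :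
    c ≤ γ * n * y ^ 36 := by
  have h80 : y ^ 9 ≤ n := by
    have h1 : y ^ 9 ≤ y ^ 80 := pow_le_pow_right₀ hy (by norm_num)
    have h2 : 1 ≤ 8 * (γ + 2) ^ 2 := by nlinarith
    nlinarith [le_mul_of_one_le_left (by positivity : 0 ≤ y ^ 80) h2]
  have hinv : 1 / n ≤ (y ^ 9)⁻¹ := by
    rw [one_div]
    exact inv_anti₀ (by positivity) h80
  have h1 : M * (1 / n + (y ^ 9)⁻¹) ≤ 2 * (γ + 2) * (n * y ^ 31) := by
    calc _ ≤ ((γ + 2) * n * y ^ 40) * ((y ^ 9)⁻¹ + (y ^ 9)⁻¹) := by gcongr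
      _ = _ := by
        field_simp
        ring
  have h2 : (κ + n * y ^ 22) / (y ^ 9)⁻¹ ≤ 2 * (n * y ^ 31) := by
    rw [div_inv_eq_mul]
    have h3 : n ≤ n * y ^ 22 := le_mul_of_one_le_right (by linarith) (one_le_pow₀ hy)
    calc _ ≤ (n * y ^ 22 + n * y ^ 22) * y ^ 9 := by gcongr; linarith
      _ = _ := by ring
  have h3 : n * y ^ 22 ≤ n * y ^ 31 := by
    gcongr
    norm_num
  have h4 : c * ((y ^ 4)⁻¹ / 3) ≤ (2 * (γ + 2) + 3) * (n * y ^ 31) := by linarith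
  have h5 : c = c * ((y ^ 4)⁻¹ / 3) * (3 * y ^ 4) := by
    field_simp
  calc c ≤ (2 * (γ + 2) + 3) * (n * y ^ 31) * (3 * y ^ 4) := by
        rw [h5]
        gcongr
    _ = 3 * (2 * (γ + 2) + 3) * (n * y ^ 35) := by ring
    _ ≤ γ * y * (n * y ^ 35) := by gcongr
    _ = _ := by ring

/-- The quantitative form of the theorem, with `log n = y ^ 40`. -/
theorem one_sub_exp_le_Pr {γ y : ℝ} (hγ : 0 < γ) {k : ℕ} (hk : 2 ≤ k)
    (hL : Real.log (2 * k) = y ^ 40) (hy : 2 ≤ y) (hyK : 4 * (γ + 2) + 4 ≤ y ^ 2)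
    (hyγ : 3 * (2 * (γ + 2) + 3) ≤ γ * y) (hyn : 8 * (γ + 2) ^ 2 * y ^ 80 ≤ 2 * k) :
    1 - Real.exp (-((2 * k : ℕ) : ℝ)) ≤ Pr (2*k) (fun σ =>
        (((Finset.Ico (⌈(2*k : ℝ) * Real.sqrt (Real.log (2*k))⌉₊)
              (⌈(2*k : ℝ) * Real.sqrt (Real.log (2*k))⌉₊ + ⌊γ * (2*k) * Real.log (2*k)⌋₊)).filter
            (fun m => ((1:ℝ)/2 + (Real.log (2*k)) ^ (-(1:ℝ)/10)) * (2*k) <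
              ((minCoverUnion (KonigProc σ m)).card : ℝ))).card : ℝ)
          ≤ γ * (2*k) * (Real.log (2*k)) ^ ((9:ℝ)/10)) := by
  have hy0 : 0 ≤ y := by linarith
  have hsqrt : Real.sqrt (y ^ 40) = y ^ 20 := by
    rw [show y ^ 40 = (y ^ 20) ^ 2 by ring, Real.sqrt_sq (by positivity)]
  have hεy : (y ^ 40) ^ (-(1 : ℝ) / 10) = (y ^ 4)⁻¹ := by
    rw [← Real.rpow_natCast, ← Real.rpow_mul hy0, ← Real.rpow_natCast, ← Real.rpow_neg hy0]
    norm_num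
  have h36 : (y ^ 40) ^ ((9 : ℝ) / 10) = y ^ 36 := by
    rw [← Real.rpow_natCast, ← Real.rpow_mul hy0, ← Real.rpow_natCast]
    norm_num
  rw [hL, hsqrt, hεy, h36]
  have hk' : (2 : ℝ) ≤ k := by exact_mod_cast hk
  have hn1 : (1 : ℝ) ≤ 2 * k := by linarith
  have hMle := ceil_add_floor_le hγ hn1 (by linarith : 1 ≤ y)
  set m₀ := ⌈(2 * k : ℝ) * y ^ 20⌉₊ with hm₀
  set M := m₀ + ⌊γ * (2 * k) * y ^ 40⌋₊ with hMdef
  have hN : (2 * k : ℝ) ^ 2 / 4 ≤ (((2 * k) * (2 * k - 1) / 2 : ℕ) : ℝ) := by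
    rw [cast_two_mul_choose_two]
    nlinarith
  obtain ⟨hMN, hexp⟩ := deviation_exponent_le (by linarith : 1 ≤ γ + 2) hn1
    (by linarith : 1 ≤ y) hyK hyn hN (Nat.cast_nonneg M) hMle
  have hMN' : M < (2 * k) * (2 * k - 1) / 2 := by exact_mod_cast hMN
  have hr : (y ^ 20)⁻¹ ≤ 1 / 2 := by
    rw [one_div]
    exact inv_anti₀ (by norm_num) (hy.trans (le_self_pow₀ (by linarith) (by norm_num)))
  have htail := card_exists_deviation_le (by positivity) hr hMN' (2 * k * y ^ 22)
  have hsmall := two_pow_add_one_mul_exp_le (n := 2 * k) (by omega)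
    (hexp.trans_eq (by rw [Nat.cast_mul, Nat.cast_ofNat]))
  have hrare := htail.trans (mul_le_mul_of_nonneg_right hsmall (Nat.cast_nonneg _))
  refine one_sub_le_Pr hrare ?_
  intro σ hσ
  push Not at hσ
  have hbad := card_filter_minCoverUnion_le hk σ hMN' (ε := (y ^ 4)⁻¹) (η := (y ^ 9)⁻¹)
    (by positivity) (by positivity) hσ.1 hσ.2
  have hsub : (((Ico m₀ M).filter fun m => ((1 : ℝ) / 2 + (y ^ 4)⁻¹) * (2 * k) <
      ((minCoverUnion (KonigProc σ m)).card : ℝ)).card : ℝ) ≤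
        ((range M).filter fun m => (1 / 2 + (y ^ 4)⁻¹) * (2 * k) <
          ((minCoverUnion (KonigProc σ m)).card : ℝ)).card := by
    refine Nat.cast_le.2 (card_le_card (filter_subset_filter _ fun m hm => ?_))
    exact mem_range.2 (mem_Ico.1 hm).2
  refine hsub.trans ?_
  exact le_of_mul_le_deviation_bound hγ hn1 (by linarith) (by linarith) hMle
    hyγ hyn hbad

theorem eventually_one_sub_exp_le_Pr {γ : ℝ} (hγ : 0 < γ) : ∀ᶠ k : ℕ in Filter.atTop,
    1 - Real.exp (-((2 * k : ℕ) : ℝ)) ≤ Pr (2*k) (fun σ =>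
        (((Finset.Ico (⌈(2*k : ℝ) * Real.sqrt (Real.log (2*k))⌉₊)
              (⌈(2*k : ℝ) * Real.sqrt (Real.log (2*k))⌉₊ + ⌊γ * (2*k) * Real.log (2*k)⌋₊)).filter
            (fun m => ((1:ℝ)/2 + (Real.log (2*k)) ^ (-(1:ℝ)/10)) * (2*k) <
              ((minCoverUnion (KonigProc σ m)).card : ℝ))).card : ℝ)
          ≤ γ * (2*k) * (Real.log (2*k)) ^ ((9:ℝ)/10)) := by
  have hcast : Filter.Tendsto (fun k : ℕ => (2 * k : ℝ)) Filter.atTop Filter.atTop :=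
    tendsto_natCast_atTop_atTop.const_mul_atTop (by norm_num)
  have hy : Filter.Tendsto (fun k : ℕ => Real.log (2 * k) ^ ((1 : ℝ) / 40))
      Filter.atTop Filter.atTop :=
    (tendsto_rpow_atTop (by norm_num)).comp (Real.tendsto_log_atTop.comp hcast)
  have hlog : ∀ᶠ k : ℕ in Filter.atTop,
      ‖Real.log (2 * k) ^ 2‖ ≤ (1 / (8 * (γ + 2) ^ 2)) * ‖(2 * k : ℝ)‖ :=
    hcast.eventually ((Real.isLittleO_pow_log_id_atTop (n := 2)).bound (by positivity))
  filter_upwards [Filter.eventually_ge_atTop 2, hlog, hy.eventually_ge_atTop 2,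
    hy.eventually_ge_atTop (4 * (γ + 2) + 4),
    hy.eventually_ge_atTop (3 * (2 * (γ + 2) + 3) / γ)] with k hk hlog hy2 hyK hyγ
  have hk' : (2 : ℝ) ≤ k := by exact_mod_cast hk
  have hL0 : 0 ≤ Real.log (2 * k) := Real.log_nonneg (by linarith)
  have hL : Real.log (2 * k) = (Real.log (2 * k) ^ ((1 : ℝ) / 40)) ^ 40 := by
    rw [← Real.rpow_natCast, ← Real.rpow_mul hL0]
    norm_num
  refine one_sub_exp_le_Pr hγ hk hL hy2 (by nlinarith) ?_ ?_
  · rw [div_le_iff₀ hγ] at hyγ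
    linarith
  · rw [show ∀ z : ℝ, z ^ 80 = (z ^ 40) ^ 2 from fun z => by ring, ← hL]
    rw [Real.norm_of_nonneg (by positivity), Real.norm_of_nonneg (by positivity),
      div_mul_eq_mul_div, one_mul, le_div_iff₀ (by positivity)] at hlog
    linarith

/-- With `m₀ = ⌈n √(log n)⌉` and `T = T(m₀, ⌊γ n log n⌋)`, whp at most `γ n (log n)^{9/10}`
indices `m ∈ T` satisfy `|D_m| > (1/2 + (log n)^{−1/10}) n`. -/
theorem koenig_process_cover_frozen (γ : ℝ) (hγ : 0 < γ) :
    Filter.Tendsto (fun k : ℕ =>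
      Pr (2*k) (fun σ =>
        (((Finset.Ico (⌈(2*k : ℝ) * Real.sqrt (Real.log (2*k))⌉₊)
              (⌈(2*k : ℝ) * Real.sqrt (Real.log (2*k))⌉₊ + ⌊γ * (2*k) * Real.log (2*k)⌋₊)).filter
            (fun m => ((1:ℝ)/2 + (Real.log (2*k)) ^ (-(1:ℝ)/10)) * (2*k) <
              ((minCoverUnion (KonigProc σ m)).card : ℝ))).card : ℝ)
          ≤ γ * (2*k) * (Real.log (2*k)) ^ ((9:ℝ)/10)))
      Filter.atTop (nhds 1) := by
  have hexp : Filter.Tendsto (fun k : ℕ => 1 - Real.exp (-((2 * k : ℕ) : ℝ)))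
      Filter.atTop (nhds 1) := by
    have h : Filter.Tendsto (fun k : ℕ => ((2 * k : ℕ) : ℝ)) Filter.atTop Filter.atTop :=
      tendsto_natCast_atTop_atTop.comp (Filter.tendsto_id.const_mul_atTop' (by norm_num))
    simpa using (Real.tendsto_exp_neg_atTop_nhds_zero.comp h).const_sub 1
  exact tendsto_of_tendsto_of_tendsto_of_le_of_le' hexp tendsto_const_nhds
    (eventually_one_sub_exp_le_Pr hγ) (Filter.Eventually.of_forall fun k => Pr_le_one _)
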